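/- Let T be a finite-dimensional complex vector space and U a 2-dimensional complex vector space. Consider the conjugation action of PGL(U) on T ⊗ End(U) (acting trivially on T). If dim T = 2, the GIT quotient (T ⊗ End(U)) // PGL(U) is isomorphic to affine space A⁵; similarly, for the action of G_m × G_m on a direct sum T₁₁ ⊕ T₁₂ ⊕ T₂₁ ⊕ T₂₂ of vector spaces with dims summing to 6 (each T_ij of dimension appropriate to Ext¹(I_{ℓᵢ},I_{ℓⱼ})), where (t,t') acts by weight 0 on T₁₁,T₂₂, weight t/t' on T₁₂, and t'/t on T₂₁, the quotient is isomorphic to A⁵. -/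

import Mathlib

noncomputable section

open Matrix

/-- `2 × 2` complex matrices, i.e. `End(U)` for `U` a 2-dimensional complex
vector space (in a fixed basis). -/
abbrev M2 : Type := Matrix (Fin 2) (Fin 2) ℂ

/-- `V₁ = T ⊗ End(U)` with `dim T = 2` and `dim U = 2`: a pair of `2 × 2`
matrices. -/
abbrev V1 : Type := M2 × M2

/-- The conjugation action of `GL(U)` on `V₁ = T ⊗ End(U)` (trivial on the
factor `T`); since the center acts trivially, this is exactly the conjugation
action of `PGL(U)`. -/
def conjAct (g : GL (Fin 2) ℂ) (v : V1) : V1 :=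
  ((g : M2) * v.1 * ((g⁻¹ : GL (Fin 2) ℂ) : M2),
   (g : M2) * v.2 * ((g⁻¹ : GL (Fin 2) ℂ) : M2))

/-- The linear coordinates on `V₁`. -/
def coord1 (x : Fin 2 × Fin 2 × Fin 2) (v : V1) : ℂ :=
  if x.1 = 0 then v.1 x.2.1 x.2.2 else v.2 x.2.1 x.2.2

/-- The algebra of polynomial (regular) functions on the affine space `V₁`. -/
def polyFuns1 : Subalgebra ℂ (V1 → ℂ) :=
  (MvPolynomial.aeval (fun x (v : V1) => coord1 x v) :
    MvPolynomial (Fin 2 × Fin 2 × Fin 2) ℂ →ₐ[ℂ] (V1 → ℂ)).range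

/-- The algebra of `PGL(U)`-invariant functions on `V₁`. -/
def invFuns1 : Subalgebra ℂ (V1 → ℂ) where
  carrier := {f | ∀ g v, f (conjAct g v) = f v}
  mul_mem' := fun ha hb g v => by
    simp only [Pi.mul_apply, ha g v, hb g v]
  add_mem' := fun ha hb g v => by
    simp only [Pi.add_apply, ha g v, hb g v]
  algebraMap_mem' := fun c g v => rfl

/-- `V₂ = T₁₁ ⊕ T₁₂ ⊕ T₂₁ ⊕ T₂₂` with `dim T₁₁ = dim T₂₂ = 2` and
`dim T₁₂ = dim T₂₁ = 1` (total dimension 6), the model for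
`Ext¹(I_{ℓ₁} ⊕ I_{ℓ₂}, I_{ℓ₁} ⊕ I_{ℓ₂})` with `ℓ₁ ≠ ℓ₂`. -/
abbrev V2 : Type := (Fin 2 → ℂ) × ℂ × ℂ × (Fin 2 → ℂ)

/-- The action of the torus `G_m × G_m`: `(t, t')` acts trivially on
`T₁₁` and `T₂₂`, by the weight `t/t'` on `T₁₂` and by `t'/t` on `T₂₁`. -/
def torusAct (t : ℂˣ × ℂˣ) (v : V2) : V2 :=
  (v.1, ((t.1 : ℂ) * ((t.2⁻¹ : ℂˣ) : ℂ)) * v.2.1,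
   ((t.2 : ℂ) * ((t.1⁻¹ : ℂˣ) : ℂ)) * v.2.2.1, v.2.2.2)

/-- The linear coordinates on `V₂`. -/
def coord2 : (Fin 2 ⊕ Unit ⊕ Unit ⊕ Fin 2) → V2 → ℂ
  | Sum.inl i => fun v => v.1 i
  | Sum.inr (Sum.inl _) => fun v => v.2.1
  | Sum.inr (Sum.inr (Sum.inl _)) => fun v => v.2.2.1
  | Sum.inr (Sum.inr (Sum.inr i)) => fun v => v.2.2.2 i

/-- The algebra of polynomial (regular) functions on the affine space `V₂`. -/
def polyFuns2 : Subalgebra ℂ (V2 → ℂ) :=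
  (MvPolynomial.aeval (fun x (v : V2) => coord2 x v) :
    MvPolynomial (Fin 2 ⊕ Unit ⊕ Unit ⊕ Fin 2) ℂ →ₐ[ℂ] (V2 → ℂ)).range

/-- The algebra of `G_m × G_m`-invariant functions on `V₂`. -/
def invFuns2 : Subalgebra ℂ (V2 → ℂ) where
  carrier := {f | ∀ t v, f (torusAct t v) = f v}
  mul_mem' := fun ha hb t v => by
    simp only [Pi.mul_apply, ha t v, hb t v]
  add_mem' := fun ha hb t v => by
    simp only [Pi.add_apply, ha t v, hb t v]
  algebraMap_mem' := fun c t v => rfl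

open MvPolynomial in
/-- Polynomial functions in coordinates `c` pull back along `s` into `A` as soon as the
coordinates do. -/
lemma comp_mem_of_mem_range_aeval {σ V W : Type*} {c : σ → V → ℂ} {s : W → V}
    {A : Subalgebra ℂ (W → ℂ)} (hs : ∀ i, (fun w => c i (s w)) ∈ A) {f : V → ℂ}
    (hf : f ∈ (aeval c : MvPolynomial σ ℂ →ₐ[ℂ] (V → ℂ)).range) :
    (fun w => f (s w)) ∈ A := by
  obtain ⟨p, rfl⟩ := hf
  induction p using MvPolynomial.induction_on with
  | C a =>
    convert A.algebraMap_mem a using 1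
    ext w
    simp
  | add p q hp hq =>
    convert A.add_mem hp hq using 1
    ext w
    simp
  | mul_X p i hp =>
    convert A.mul_mem hp (hs i) using 1
    ext w
    simp

lemma aeval_pi_apply {σ V : Type*} (c : σ → V → ℂ) (p : MvPolynomial σ ℂ) (v : V) :
    MvPolynomial.aeval c p v = MvPolynomial.eval (fun i => c i v) p := by
  induction p using MvPolynomial.induction_on with
  | C a => simp
  | add p q hp hq => simp [hp, hq]
  | mul_X p i hp => simp [hp]

lemma eval_mem_of_forall_mem {τ V : Type*} {A : Subalgebra ℂ (V → ℂ)} {π : τ → V → ℂ}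
    (hπ : ∀ i, π i ∈ A) (Q : MvPolynomial τ ℂ) :
    (fun v => MvPolynomial.eval (fun i => π i v) Q) ∈ A := by
  have hle : (MvPolynomial.aeval π : MvPolynomial τ ℂ →ₐ[ℂ] (V → ℂ)).range ≤ A := by
    rw [← Algebra.adjoin_range_eq_range_aeval, Algebra.adjoin_le_iff]
    rintro _ ⟨i, rfl⟩
    exact hπ i
  simp only [← aeval_pi_apply]
  exact hle ⟨Q, rfl⟩

lemma aeval_injective_of_surjective {σ V : Type*} {c : σ → V → ℂ}
    (hc : ∀ x : σ → ℂ, ∃ v, ∀ i, c i v = x i) :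
    Function.Injective (MvPolynomial.aeval c : MvPolynomial σ ℂ →ₐ[ℂ] (V → ℂ)) := by
  intro p q hpq
  refine MvPolynomial.funext fun x => ?_
  obtain ⟨v, hv⟩ := hc x
  have h := congrFun hpq v
  rwa [aeval_pi_apply, aeval_pi_apply, funext hv] at h

/-- Two polynomial functions which agree off the zero locus of a nonzero polynomial function
are equal. -/
lemma eq_of_eq_off_zero_locus {σ V : Type*} {c : σ → V → ℂ}
    (hc : ∀ x : σ → ℂ, ∃ v, ∀ i, c i v = x i) {f g w : V → ℂ}
    (hf : f ∈ (MvPolynomial.aeval c : MvPolynomial σ ℂ →ₐ[ℂ] (V → ℂ)).range)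
    (hg : g ∈ (MvPolynomial.aeval c : MvPolynomial σ ℂ →ₐ[ℂ] (V → ℂ)).range)
    (hw : w ∈ (MvPolynomial.aeval c : MvPolynomial σ ℂ →ₐ[ℂ] (V → ℂ)).range)
    (hw0 : w ≠ 0) (h : ∀ v, w v ≠ 0 → f v = g v) : f = g := by
  obtain ⟨p, rfl⟩ := hf
  obtain ⟨q, rfl⟩ := hg
  obtain ⟨r, rfl⟩ := hw
  have hr : r ≠ 0 := by
    rintro rfl
    simp at hw0
  have : r * (p - q) = 0 := by
    apply aeval_injective_of_surjective hc
    ext v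
    by_cases hv : MvPolynomial.aeval c r v = 0
    · simp [hv]
    · have := h v hv
      simp_all
  rcases mul_eq_zero.1 this with h0 | h0
  · exact absurd h0 hr
  · rw [sub_eq_zero.1 h0]

/-- Algebraically independent generators, given as the components of a surjective map,
identify a subalgebra of functions with a polynomial ring. -/
lemma nonempty_algEquiv_of_generators {τ V : Type*} (S : Subalgebra ℂ (V → ℂ))
    (π : τ → V → ℂ) (hπ : ∀ x : τ → ℂ, ∃ v, ∀ i, π i v = x i) (hmem : ∀ i, π i ∈ S)
    (hgen : ∀ f ∈ S, ∃ Q : MvPolynomial τ ℂ, ∀ v, f v = MvPolynomial.eval (fun i => π i v) Q) :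
    Nonempty (S ≃ₐ[ℂ] MvPolynomial τ ℂ) := by
  have hS : (MvPolynomial.aeval π : MvPolynomial τ ℂ →ₐ[ℂ] (V → ℂ)).range = S := by
    apply le_antisymm
    · rintro _ ⟨Q, rfl⟩
      convert eval_mem_of_forall_mem hmem Q using 1
      exact funext fun v => aeval_pi_apply π Q v
    · intro f hf
      obtain ⟨Q, hQ⟩ := hgen f hf
      exact ⟨Q, funext fun v => by simpa [aeval_pi_apply] using (hQ v).symm⟩
  exact ⟨((AlgEquiv.ofInjective _ (aeval_injective_of_surjective hπ)).trans
    (Subalgebra.equivOfEq _ _ hS)).symm⟩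

lemma exists_coord1 (x : Fin 2 × Fin 2 × Fin 2 → ℂ) : ∃ v, ∀ i, coord1 i v = x i := by
  refine ⟨(Matrix.of fun i j => x (0, i, j), Matrix.of fun i j => x (1, i, j)), ?_⟩
  rintro ⟨i, j, k⟩
  fin_cases i <;> simp [coord1]

lemma exists_coord2 (x : Fin 2 ⊕ Unit ⊕ Unit ⊕ Fin 2 → ℂ) : ∃ v, ∀ i, coord2 i v = x i := by
  refine ⟨(fun i => x (.inl i), x (.inr (.inl ())), x (.inr (.inr (.inl ()))),
    fun i => x (.inr (.inr (.inr i)))), ?_⟩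
  rintro (i | i | i | i) <;> rfl

/-- The generators `a₀, a₁, xy, b₀, b₁` of the torus invariants on `V₂`. -/
def torusInv (i : Fin 5) (v : V2) : ℂ :=
  ![v.1 0, v.1 1, v.2.1 * v.2.2.1, v.2.2.2 0, v.2.2.2 1] i

/-- A section of the torus quotient of `V₂`. -/
def torusSlice (x : Fin 5 → ℂ) : V2 := (![x 0, x 1], x 2, 1, ![x 3, x 4])

open MvPolynomial in
lemma torusInv_mem (i : Fin 5) : torusInv i ∈ polyFuns2 ⊓ invFuns2 := by
  refine ⟨⟨![X (.inl 0), X (.inl 1), X (.inr (.inl ())) * X (.inr (.inr (.inl ()))),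
    X (.inr (.inr (.inr 0))), X (.inr (.inr (.inr 1)))] i, ?_⟩, fun t v => ?_⟩
  · ext v
    fin_cases i <;> simp [torusInv, coord2]
  · have h1 := t.1.ne_zero
    have h2 := t.2.ne_zero
    fin_cases i <;> simp [torusInv, torusAct]
    field_simp

open MvPolynomial in
lemma exists_eval_torusInv (f : V2 → ℂ) (hf : f ∈ polyFuns2 ⊓ invFuns2) :
    ∃ Q : MvPolynomial (Fin 5) ℂ, ∀ v, f v = eval (fun i => torusInv i v) Q := by
  obtain ⟨hp, hi⟩ := hf
  have hs : (fun x => f (torusSlice x)) ∈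
      (aeval (fun i (x : Fin 5 → ℂ) => x i) : MvPolynomial (Fin 5) ℂ →ₐ[ℂ] _).range := by
    refine comp_mem_of_mem_range_aeval (fun i => ?_) hp
    refine ⟨Sum.elim ![X 0, X 1] (Sum.elim (fun _ => X 2) (Sum.elim (fun _ => 1)
      ![X 3, X 4])) i, ?_⟩
    ext x
    rcases i with i | i | i | i
    · fin_cases i <;> simp [coord2, torusSlice]
    · simp [coord2, torusSlice]
    · simp [coord2, torusSlice]
    · fin_cases i <;> simp [coord2, torusSlice]
  obtain ⟨Q, hQ⟩ := hs
  refine ⟨Q, congrFun (eq_of_eq_off_zero_locus (w := fun v => v.2.2.1) exists_coord2 hp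
    ?_ ?_ ?_ ?_)⟩
  · exact eval_mem_of_forall_mem (fun i => (torusInv_mem i).1) Q
  · exact ⟨X (.inr (.inr (.inl ()))), by ext v; simp [coord2]⟩
  · intro h
    simpa using congrFun h (0, 0, 1, 0)
  · intro v hv
    have h1 := hi (Units.mk0 _ hv, 1) v
    rw [← h1]
    have h2 : torusAct (Units.mk0 _ hv, 1) v = torusSlice fun i => torusInv i v := by
      refine Prod.ext ?_ (Prod.ext ?_ (Prod.ext ?_ ?_))
      · ext i; fin_cases i <;> simp [torusAct, torusSlice, torusInv]
      · simp [torusAct, torusSlice, torusInv, mul_comm]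
      · simp [torusAct, torusSlice, torusInv, hv]
      · ext i; fin_cases i <;> simp [torusAct, torusSlice, torusInv]
    rw [h2]
    have h3 := congrFun hQ fun i => torusInv i v
    simpa [aeval_pi_apply] using h3.symm

lemma exists_torusInv (x : Fin 5 → ℂ) : ∃ v, ∀ i, torusInv i v = x i := by
  refine ⟨torusSlice x, fun i => ?_⟩
  fin_cases i <;> simp [torusInv, torusSlice]

/-- The generators of the invariants of a pair `(A, B)` of `2 × 2` matrices: the traces, and the
Gram matrix of the traceless parts for the form `2 tr (X Y)`. -/
def conjInv (i : Fin 5) (v : V1) : ℂ :=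
  ![v.1 0 0 + v.1 1 1, v.2 0 0 + v.2 1 1,
    (v.1 0 0 - v.1 1 1) ^ 2 + 4 * v.1 0 1 * v.1 1 0,
    (v.1 0 0 - v.1 1 1) * (v.2 0 0 - v.2 1 1) + 2 * (v.1 0 1 * v.2 1 0 + v.1 1 0 * v.2 0 1),
    (v.2 0 0 - v.2 1 1) ^ 2 + 4 * v.2 0 1 * v.2 1 0] i

/-- A family of normal forms meeting the generic conjugacy class. -/
def conjSlice (x : Fin 5 → ℂ) : V1 :=
  (!![x 0 / 2, x 2 / 4; 1, x 0 / 2],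
   !![x 1 / 2 + x 4 / 2, x 3 * x 2 / 4; x 3, x 1 / 2 - x 4 / 2])

lemma conjInv_eq_trace (v : V1) : (fun i => conjInv i v) =
    ![v.1.trace, v.2.trace, 2 * (v.1 * v.1).trace - v.1.trace ^ 2,
      2 * (v.1 * v.2).trace - v.1.trace * v.2.trace,
      2 * (v.2 * v.2).trace - v.2.trace ^ 2] := by
  ext i
  fin_cases i <;> simp [conjInv, Matrix.trace_fin_two, Matrix.mul_apply, Fin.sum_univ_two] <;> ring

lemma conjInv_conjAct (g : GL (Fin 2) ℂ) (v : V1) (i : Fin 5) :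
    conjInv i (conjAct g v) = conjInv i v := by
  have key (X : M2) :
      ((g : M2) * X * ((g⁻¹ : GL (Fin 2) ℂ) : M2)).trace = X.trace := by
    rw [Matrix.trace_mul_cycle, ← Units.val_mul, inv_mul_cancel, Units.val_one, one_mul]
  have hmul (X Y : M2) : ((g : M2) * X * ((g⁻¹ : GL (Fin 2) ℂ) : M2)) *
      ((g : M2) * Y * ((g⁻¹ : GL (Fin 2) ℂ) : M2)) =
      (g : M2) * (X * Y) * ((g⁻¹ : GL (Fin 2) ℂ) : M2) := by
    simp only [mul_assoc, Units.inv_mul_cancel_left]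
  refine congrFun (?_ : (fun i => conjInv i (conjAct g v)) = fun i => conjInv i v) i
  simp only [conjInv_eq_trace, conjAct, hmul, key]

open MvPolynomial in
lemma conjInv_mem (i : Fin 5) : conjInv i ∈ polyFuns1 ⊓ invFuns1 := by
  refine ⟨⟨![X (0, 0, 0) + X (0, 1, 1), X (1, 0, 0) + X (1, 1, 1),
    (X (0, 0, 0) - X (0, 1, 1)) ^ 2 + 4 * X (0, 0, 1) * X (0, 1, 0),
    (X (0, 0, 0) - X (0, 1, 1)) * (X (1, 0, 0) - X (1, 1, 1)) +
      2 * (X (0, 0, 1) * X (1, 1, 0) + X (0, 1, 0) * X (1, 0, 1)),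
    (X (1, 0, 0) - X (1, 1, 1)) ^ 2 + 4 * X (1, 0, 1) * X (1, 1, 0)] i, ?_⟩,
    fun g v => conjInv_conjAct g v i⟩
  ext v
  fin_cases i <;> simp [conjInv, coord1]

lemma exists_conjInv (x : Fin 5 → ℂ) : ∃ v, ∀ i, conjInv i v = x i := by
  obtain ⟨β, hβ⟩ := IsAlgClosed.exists_pow_nat_eq (x 4) two_pos
  refine ⟨(!![x 0 / 2, x 2 / 4; 1, x 0 / 2],
    !![x 1 / 2 + β / 2, x 3 / 2; 0, x 1 / 2 - β / 2]), fun i => ?_⟩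
  fin_cases i <;> simp [conjInv]
  · ring
  · ring
  · linear_combination hβ

/-- A generic pair of matrices is conjugate to a normal form; the columns of the conjugating
matrix are an eigenvector of `[p, q; r, -p]` and its image under `[a, b; c, -a]`. -/
lemma exists_conjAct_conjSlice {a b c p q r β : ℂ} (e t₁ t₂ : ℂ)
    (h1 : 2 * a * p + b * r + c * q = 0) (h2 : p ^ 2 + q * r = (β / 2) ^ 2)
    (hq : q ≠ 0) (hβ : β ≠ 0) (hD : a ^ 2 + b * c ≠ 0) :
    ∃ g, conjAct g (conjSlice ![t₁, t₂, 4 * (a ^ 2 + b * c), e, β]) =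
      (!![t₁ / 2 + a, b; c, t₁ / 2 - a],
       !![t₂ / 2 + e * a + p, e * b + q; e * c + r, t₂ / 2 - e * a - p]) := by
  set y := β / 2 - p with hy
  set h : M2 := !![q, a * q + b * y; y, c * q - a * y] with hh
  have hdet : h.det ≠ 0 := by
    have e1 : h.det = -β * (a * q - b * p + b * β / 2) := by
      rw [hh, Matrix.det_fin_two_of, hy]
      linear_combination q * h1 + (-b) * h2
    have e2 : (a * q - b * p) ^ 2 - (b * β / 2) ^ 2 = q ^ 2 * (a ^ 2 + b * c) := by
      linear_combination b ^ 2 * h2 - b * q * h1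
    rw [e1]
    refine mul_ne_zero (neg_ne_zero.2 hβ) fun h0 => ?_
    have : q ^ 2 * (a ^ 2 + b * c) = 0 := by
      rw [← e2]
      linear_combination (a * q - b * p - b * β / 2) * h0
    exact mul_ne_zero (pow_ne_zero 2 hq) hD this
  have conj {X Y : M2} (hXY : h * X = Y * h) :
      ((Matrix.GeneralLinearGroup.mkOfDetNeZero h hdet : GL (Fin 2) ℂ) : M2) * X *
        (((Matrix.GeneralLinearGroup.mkOfDetNeZero h hdet)⁻¹ : GL (Fin 2) ℂ) : M2) = Y := by
    rw [Units.mul_inv_eq_iff_eq_mul]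
    exact hXY
  refine ⟨Matrix.GeneralLinearGroup.mkOfDetNeZero h hdet, Prod.ext (conj ?_) (conj ?_)⟩
  · ext i j
    fin_cases i <;> fin_cases j <;>
      simp [hh, conjSlice, Matrix.mul_apply, Fin.sum_univ_two] <;> ring
  · ext i j
    fin_cases i <;> fin_cases j <;>
      simp [hh, hy, conjSlice, Matrix.mul_apply, Fin.sum_univ_two]
    · ring
    · linear_combination b * h2 - q * h1
    · linear_combination -h2
    · linear_combination -(β / 2 - p) * h1 - a * h2

open MvPolynomial in
/-- Clearing denominators: on `β² = F - E² / D`, a polynomial in `E / D` and `β` is linear in `β`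
up to a power of `D`. -/
lemma exists_clear_denominators (P : MvPolynomial (Fin 5) ℂ) :
    ∃ (k : ℕ) (Q R : MvPolynomial (Fin 5) ℂ), ∀ t₁ t₂ D E F β : ℂ, D ≠ 0 →
      β ^ 2 = F - E ^ 2 / D →
      D ^ k * eval ![t₁, t₂, D, E / D, β] P =
        eval ![t₁, t₂, D, E, F] Q + β * eval ![t₁, t₂, D, E, F] R := by
  induction P using MvPolynomial.induction_on with
  | C a => exact ⟨0, C a, 0, by simp⟩
  | add p q hp hq =>
    obtain ⟨k, Q, R, h⟩ := hp
    obtain ⟨l, Q', R', h'⟩ := hq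
    refine ⟨k + l, X 2 ^ l * Q + X 2 ^ k * Q', X 2 ^ l * R + X 2 ^ k * R', ?_⟩
    intro t₁ t₂ D E F β hD hβ
    have h := h t₁ t₂ D E F β hD hβ
    have h' := h' t₁ t₂ D E F β hD hβ
    simp only [map_add, map_mul, map_pow, eval_X, Matrix.cons_val]
    linear_combination D ^ l * h + D ^ k * h'
  | mul_X p i hp =>
    obtain ⟨k, Q, R, h⟩ := hp
    refine ⟨k + 1, X 2 * ![Q * X 0, Q * X 1, Q * X 2, 0, 0] i + ![0, 0, 0, Q * X 3,
      (X 4 * X 2 - X 3 ^ 2) * R] i,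
      X 2 * ![R * X 0, R * X 1, R * X 2, 0, Q] i + ![0, 0, 0, R * X 3, 0] i, ?_⟩
    intro t₁ t₂ D E F β hD hβ
    have h := h t₁ t₂ D E F β hD hβ
    have hE : D * (E / D) = E := by field_simp
    have hβ' : D * β ^ 2 = F * D - E ^ 2 := by rw [hβ]; field_simp
    fin_cases i <;>
      simp only [Fin.zero_eta, Fin.mk_one, Fin.reduceFinMk, map_add, map_sub, map_mul, map_pow,
        eval_X, Matrix.cons_val, map_zero]
    · linear_combination D * t₁ * h
    · linear_combination D * t₂ * h
    · linear_combination D * D * h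
    · linear_combination E * h + D ^ k * eval ![t₁, t₂, D, E / D, β] p * hE
    · linear_combination D * β * h + eval ![t₁, t₂, D, E, F] R * hβ'

open MvPolynomial in
/-- Splitting off the constant term with respect to one variable. -/
lemma exists_eval_eq_mul_add_update {σ : Type*} [DecidableEq σ] (i : σ) (P : MvPolynomial σ ℂ) :
    ∃ Q : MvPolynomial σ ℂ, ∀ x : σ → ℂ,
      eval x P = x i * eval x Q + eval (Function.update x i 0) P := by
  induction P using MvPolynomial.induction_on with
  | C a => exact ⟨0, by simp⟩
  | add p q hp hq =>
    obtain ⟨Q, h⟩ := hp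
    obtain ⟨R, h'⟩ := hq
    refine ⟨Q + R, fun x => ?_⟩
    simp only [map_add]
    linear_combination h x + h' x
  | mul_X p j hp =>
    obtain ⟨Q, h⟩ := hp
    by_cases hj : j = i
    · subst hj
      exact ⟨p, fun x => by simp [mul_comm]⟩
    · refine ⟨Q * X j, fun x => ?_⟩
      simp only [map_mul, eval_X, Function.update_of_ne hj]
      linear_combination x j * h x

open MvPolynomial in
/-- Powers of the discriminant of `A` can be cancelled. -/
lemma exists_eval_conjInv_of_pow_mul {f : V1 → ℂ} (hf : f ∈ polyFuns1) (k : ℕ)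
    (Q : MvPolynomial (Fin 5) ℂ)
    (h : ∀ v, conjInv 2 v ^ k * f v = eval (fun i => conjInv i v) Q) :
    ∃ R : MvPolynomial (Fin 5) ℂ, ∀ v, f v = eval (fun i => conjInv i v) R := by
  induction k generalizing Q with
  | zero => exact ⟨Q, fun v => by simpa using h v⟩
  | succ k ih =>
    obtain ⟨R, hR⟩ := exists_eval_eq_mul_add_update 2 Q
    have h0 (x : Fin 5 → ℂ) : eval (Function.update x 2 0) Q = 0 := by
      obtain ⟨v, hv⟩ := exists_conjInv (Function.update x 2 0)
      have := h v
      rw [funext hv, hv 2] at this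
      simpa using this.symm
    refine ih R (congrFun (eq_of_eq_off_zero_locus exists_coord1
      (polyFuns1.mul_mem (polyFuns1.pow_mem (conjInv_mem 2).1 k) hf)
      (eval_mem_of_forall_mem (fun i => (conjInv_mem i).1) R)
      (conjInv_mem 2).1 ?_ ?_))
    · intro h
      obtain ⟨v, hv⟩ := exists_conjInv 1
      simpa [h] using hv 2
    · intro v hv
      have h1 := h v
      rw [hR, h0, add_zero] at h1
      refine mul_left_cancel₀ hv ?_
      rw [← h1]
      ring

open MvPolynomial in
lemma exists_eval_conjInv (f : V1 → ℂ) (hf : f ∈ polyFuns1 ⊓ invFuns1) :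
    ∃ Q : MvPolynomial (Fin 5) ℂ, ∀ v, f v = eval (fun i => conjInv i v) Q := by
  obtain ⟨hp, hi⟩ := hf
  have hs : (fun x => f (conjSlice x)) ∈
      (aeval (fun i (x : Fin 5 → ℂ) => x i) : MvPolynomial (Fin 5) ℂ →ₐ[ℂ] _).range := by
    refine comp_mem_of_mem_range_aeval (fun i => ?_) hp
    obtain ⟨i, j, k⟩ := i
    refine ⟨if i = 0 then !![C (1 / 2) * X 0, C (1 / 4) * X 2; 1, C (1 / 2) * X 0] j k else
      !![C (1 / 2) * (X 1 + X 4), C (1 / 4) * X 3 * X 2; X 3, C (1 / 2) * (X 1 - X 4)] j k, ?_⟩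
    ext x
    fin_cases i <;> fin_cases j <;> fin_cases k <;>
      simp [coord1, conjSlice, aeval_pi_apply] <;> ring
  obtain ⟨P, hP⟩ := hs
  obtain ⟨k, Q, R, hQR⟩ := exists_clear_denominators P
  refine exists_eval_conjInv_of_pow_mul hp k Q (congrFun (eq_of_eq_off_zero_locus
    (w := conjInv 2 * (conjInv 2 * conjInv 4 - conjInv 3 ^ 2) *
      (conjInv 2 * coord1 (1, 0, 1) - conjInv 3 * coord1 (0, 0, 1))) exists_coord1
    (polyFuns1.mul_mem (polyFuns1.pow_mem (conjInv_mem 2).1 k) hp)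
    (eval_mem_of_forall_mem (fun i => (conjInv_mem i).1) Q) ?_ ?_ ?_))
  · have hc (i) : coord1 i ∈ polyFuns1 := ⟨X i, by ext v; simp⟩
    have hc' (i) : conjInv i ∈ polyFuns1 := (conjInv_mem i).1
    exact mul_mem (mul_mem (hc' 2) (sub_mem (mul_mem (hc' 2) (hc' 4)) (pow_mem (hc' 3) 2)))
      (sub_mem (mul_mem (hc' 2) (hc _)) (mul_mem (hc' 3) (hc _)))
  · intro h
    have := congrFun h (!![1, 0; 0, -1], !![0, 1; 1, 0])
    simp only [Pi.mul_apply, Pi.sub_apply, Pi.pow_apply, Pi.zero_apply, conjInv, coord1,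
      Matrix.cons_val] at this
    norm_num at this
  · intro v hv
    obtain ⟨⟨hD, hG⟩, hq⟩ := by simpa only [Pi.mul_apply, mul_ne_zero_iff] using hv
    simp only [Pi.sub_apply, Pi.mul_apply, Pi.pow_apply, coord1] at hG hq
    set D := conjInv 2 v with hD'
    set E := conjInv 3 v with hE'
    set F := conjInv 4 v with hF'
    obtain ⟨β, hβ⟩ := IsAlgClosed.exists_pow_nat_eq (F - E ^ 2 / D) two_pos
    have hβ0 : β ≠ 0 := by
      rintro rfl
      apply hG
      field_simp at hβ
      linear_combination -hβ
    have key (γ : ℂ) (hγ : γ ^ 2 = F - E ^ 2 / D) (hγ0 : γ ≠ 0) :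
        f v = eval ![conjInv 0 v, conjInv 1 v, D, E / D, γ] P := by
      set a := (v.1 0 0 - v.1 1 1) / 2 with ha
      set b := v.1 0 1 with hb
      set c := v.1 1 0 with hc
      set e := E / D with he
      have hDa : D = 4 * (a ^ 2 + b * c) := by
        simp only [hD', ha, hb, hc, conjInv, Matrix.cons_val]
        ring
      have hEa : E = 2 * a * (v.2 0 0 - v.2 1 1) + 2 * (b * v.2 1 0 + c * v.2 0 1) := by
        simp only [hE', ha, hb, hc, conjInv, Matrix.cons_val]
        ring
      have hFa : F = (v.2 0 0 - v.2 1 1) ^ 2 + 4 * v.2 0 1 * v.2 1 0 := by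
        simp only [hF', conjInv, Matrix.cons_val]
      have heD : e * D = E := div_mul_cancel₀ E hD
      have heE : E ^ 2 / D = e * E := by rw [he]; ring
      obtain ⟨g, hg⟩ := exists_conjAct_conjSlice (a := a) (b := b) (c := c)
        (p := (v.2 0 0 - v.2 1 1) / 2 - e * a) (q := v.2 0 1 - e * b) (r := v.2 1 0 - e * c)
        (β := γ) e (conjInv 0 v) (conjInv 1 v)
        (by linear_combination (-1 / 2) * hEa + (1 / 2) * e * hDa - (1 / 2) * heD)
        (by
          rw [div_pow, hγ, heE]
          linear_combination (-1 / 4) * hFa + (1 / 2) * e * hEa - (1 / 4) * e ^ 2 * hDa +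
            (1 / 4) * e * heD)
        (fun h0 => hq (by
          simp only [one_ne_zero, if_true, if_false]
          linear_combination D * h0 + b * heD)) hγ0
        (fun h0 => hD (by rw [hDa, h0, mul_zero]))
      have hgv : conjAct g (conjSlice ![conjInv 0 v, conjInv 1 v, D, e, γ]) = v := by
        rw [hDa, hg]
        refine Prod.ext ?_ ?_ <;> ext i j <;> fin_cases i <;> fin_cases j <;>
          simp [ha, hb, hc, conjInv] <;> ring
      have h1 := hi g (conjSlice ![conjInv 0 v, conjInv 1 v, D, e, γ])
      rw [hgv] at h1
      rw [h1]
      have h2 := congrFun hP ![conjInv 0 v, conjInv 1 v, D, e, γ]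
      simpa [aeval_pi_apply] using h2.symm
    have hv5 : (fun i => conjInv i v) = ![conjInv 0 v, conjInv 1 v, D, E, F] := by
      ext i
      fin_cases i <;> rfl
    have k1 := hQR (conjInv 0 v) (conjInv 1 v) D E F β hD hβ
    have k2 := hQR (conjInv 0 v) (conjInv 1 v) D E F (-β) hD (by rw [neg_sq]; exact hβ)
    rw [← key _ hβ hβ0] at k1
    rw [← key _ (by rw [neg_sq]; exact hβ) (neg_ne_zero.2 hβ0)] at k2
    rw [hv5]
    change D ^ k * f v = _
    linear_combination (k1 + k2) / 2

/-- The GIT quotient `(T ⊗ End U) // PGL(U)` (for `dim T = dim U = 2`), i.e.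
the spectrum of the algebra of invariant polynomial functions, is the affine
space `A⁵`: the invariant ring is a polynomial ring in 5 variables. Likewise,
the GIT quotient of `T₁₁ ⊕ T₁₂ ⊕ T₂₁ ⊕ T₂₂` (dimensions `2,1,1,2` summing
to 6) by the torus `G_m × G_m` acting with weights `0, t/t', t'/t, 0` is `A⁵`. -/
theorem statement16 :
    Nonempty ((↥(polyFuns1 ⊓ invFuns1)) ≃ₐ[ℂ] MvPolynomial (Fin 5) ℂ) ∧
    Nonempty ((↥(polyFuns2 ⊓ invFuns2)) ≃ₐ[ℂ] MvPolynomial (Fin 5) ℂ) := by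
  exact ⟨nonempty_algEquiv_of_generators _ conjInv exists_conjInv conjInv_mem
      exists_eval_conjInv,
    nonempty_algEquiv_of_generators _ torusInv exists_torusInv torusInv_mem
      exists_eval_torusInv⟩
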